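/- arXiv:1609.03727 — 3 statements merged into one kernel-verified Lean document; each statement's English description precedes it below -/
import Mathlib

section
/- (Sieklucki, 1969) Let T = ([-1,1] × {0}) ∪ ({0} × [0,1]) ⊂ ℝ² be the triod (the cone over 3 points). Every continuous map φ : T → ℝ² whose range is contained in the segment [0,1] × {0} is approximable by embeddings. -/
/-- Heights `h` for the vertices `(i, s)`, `s ≤ p i`, of three lattice walks `a i` issuing from a
common origin, such that the polygonal arms through the points `(a i s, h i s)` do not cross. -/
structure PlanarHeights (a : Fin 3 → ℕ → ℤ) (p : Fin 3 → ℕ) (h : Fin 3 → ℕ → ℤ) : Prop where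
  zero : ∀ i, h i 0 = 0
  inj : ∀ i j s t, s ≤ p i → t ≤ p j → h i s = h j t → (i = j ∧ s = t) ∨ (s = 0 ∧ t = 0)
  noncrossing : ∀ i j s u t v, s ≤ p i → u ≤ p i → t ≤ p j → v ≤ p j →
    (u = s + 1 ∨ s = u + 1) → (v = t + 1 ∨ t = v + 1) →
    a i s = a j t → a i u = a j v → h i s < h j t → h i u ≤ h j v

/-- Three walks on `ℤ` starting at `0` with steps `±1`, such that no two of them have a local
extremum of the same kind at the same level. -/
structure GenericWalks (a : Fin 3 → ℕ → ℤ) : Prop where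
  zero : ∀ i, a i 0 = 0
  step : ∀ i t, a i (t + 1) = a i t + 1 ∨ a i (t + 1) = a i t - 1
  turn : ∀ i j s t, i ≠ j → a i (s + 2) = a i s → a j (t + 2) = a j t →
    a i (s + 1) ≠ a j (t + 1)

namespace GenericWalks

variable {a : Fin 3 → ℕ → ℤ}

theorem neg (ha : GenericWalks a) : GenericWalks (-a) where
  zero i := by simp [ha.zero]
  step i t := by
    have := ha.step i t
    simp only [Pi.neg_apply]
    omega
  turn i j s t hij h1 h2 h3 := by
    simp only [Pi.neg_apply, neg_inj] at h1 h2 h3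
    exact ha.turn i j s t hij h1 h2 h3

end GenericWalks

namespace PlanarHeights

variable {a h : Fin 3 → ℕ → ℤ} {p : Fin 3 → ℕ}

theorem neg (H : PlanarHeights a p h) : PlanarHeights a p (-h) where
  zero i := by simp [H.zero]
  inj i j s t hs ht e := H.inj i j s t hs ht (by simpa using e)
  noncrossing i j s s' t t' hs hs' ht ht' es et e e' hlt := by
    simp only [Pi.neg_apply] at hlt ⊢
    have := H.noncrossing j i t t' s s' ht ht' hs hs' et es e.symm e'.symm (by omega)
    omega

theorem neg_walks (H : PlanarHeights (-a) p h) : PlanarHeights a p h where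
  zero := H.zero
  inj := H.inj
  noncrossing i j s s' t t' hs hs' ht ht' es et e e' hlt :=
    H.noncrossing i j s s' t t' hs hs' ht ht' es et (by simp [e]) (by simp [e']) hlt

/-- The last vertex of arm `i` is weakly highest among the vertices at its level. -/
def TipTop (a : Fin 3 → ℕ → ℤ) (p : Fin 3 → ℕ) (h : Fin 3 → ℕ → ℤ) (i : Fin 3) : Prop :=
  ∀ j t, t ≤ p j → a j t = a i (p i) → h j t ≤ h i (p i)

theorem exists_step (ha : GenericWalks a) (H : PlanarHeights a p h) {i : Fin 3}
    (top : TipTop a p h i) :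
    ∃ h', PlanarHeights a (Function.update p i (p i + 1)) h' ∧
      (∀ j t, t ≤ p j → h' j t = h j t) ∧ ∀ j t, t ≤ p j → h j t < h' i (p i + 1) := by
  obtain ⟨B, hB⟩ : ∃ B : ℤ, ∀ j t, t ≤ p j → h j t < B := by
    have hfin : (⋃ j : Fin 3, (h j) '' Set.Iic (p j)).Finite :=
      Set.finite_iUnion fun j => (Set.finite_Iic _).image _
    obtain ⟨B, hB⟩ := hfin.bddAbove
    refine ⟨B + 1, fun j t ht => Int.lt_add_one_of_le (hB ?_)⟩
    exact Set.mem_iUnion.2 ⟨j, t, ht, rfl⟩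
  set h' : Fin 3 → ℕ → ℤ := fun j t => if j = i ∧ t = p i + 1 then B else h j t with hh'
  have hold : ∀ j t, t ≤ p j → h' j t = h j t := by
    intro j t ht
    simp only [hh']
    rw [if_neg]
    rintro ⟨rfl, rfl⟩
    omega
  have hnew : h' i (p i + 1) = B := by simp [hh']
  have hcase : ∀ j t, t ≤ Function.update p i (p i + 1) j →
      t ≤ p j ∨ (j = i ∧ t = p i + 1) := by
    intro j t ht
    by_cases hj : j = i
    · subst hj
      simp only [Function.update_self] at ht
      omega
    · rw [Function.update_of_ne hj] at ht
      exact Or.inl ht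
  refine ⟨h', ⟨fun j => ?_, ?_, ?_⟩, hold, fun j t ht => by rw [hnew]; exact hB j t ht⟩
  · rw [hold j 0 (Nat.zero_le _), H.zero]
  · intro j l s t ms mt e
    rcases hcase j s ms with hs | ⟨rfl, rfl⟩ <;> rcases hcase l t mt with ht | ⟨rfl, rfl⟩
    · rw [hold j s hs, hold l t ht] at e
      exact H.inj j l s t hs ht e
    · rw [hold j s hs, hnew] at e
      exact absurd e (hB j s hs).ne
    · rw [hold l t ht, hnew] at e
      exact absurd e.symm (hB l t ht).ne
    · exact Or.inl ⟨rfl, rfl⟩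
  · intro j l s s' t t' ms ms' mt mt' es et e e' hlt
    have hstep := ha.step i (p i)
    rcases hcase j s ms with hs | ⟨rfl, rfl⟩
    · rcases hcase j s' ms' with hs' | ⟨rfl, rfl⟩
      · rcases hcase l t mt with ht | ⟨rfl, rfl⟩
        · rcases hcase l t' mt' with ht' | ⟨rfl, rfl⟩
          · rw [hold j s hs, hold l t ht] at hlt
            rw [hold j s' hs', hold l t' ht']
            exact H.noncrossing j l s s' t t' hs hs' ht ht' es et e e' hlt
          · rw [hold j s' hs', hnew]
            exact (hB j s' hs').le
        · obtain rfl : t' = p l := by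
            rcases hcase l t' mt' with h | h <;> omega
          rw [hold j s' hs', hold l _ le_rfl]
          exact top j s' hs' e'
      · obtain rfl : s = p j := by omega
        rcases hcase l t mt with ht | ⟨rfl, rfl⟩
        · rw [hold j _ hs, hold l t ht] at hlt
          exact absurd (top l t ht e.symm) (not_le.2 hlt)
        · omega
    · rcases hcase l t mt with ht | ⟨rfl, rfl⟩
      · rw [hnew, hold l t ht] at hlt
        exact absurd (hB l t ht) (not_lt.2 hlt.le)
      · exact absurd hlt (lt_irrefl _)

theorem exists_extend (ha : GenericWalks a) (H : PlanarHeights a p h) {i : Fin 3}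
    (top : TipTop a p h i) (d : ℕ) :
    ∃ h', PlanarHeights a (Function.update p i (p i + d)) h' ∧
      (∀ j t, t ≤ p j → h' j t = h j t) ∧
      ∀ j t s, t ≤ p j → p i < s → s ≤ p i + d → h j t < h' i s := by
  induction d generalizing p h with
  | zero => exact ⟨h, by simpa using H, fun _ _ _ => rfl, fun j t s _ h1 h2 => by omega⟩
  | succ d ih =>
    obtain ⟨h', H', hold, hnew⟩ := exists_step ha H top
    have hle : ∀ j t, t ≤ p j → t ≤ Function.update p i (p i + 1) j := by
      intro j t ht
      by_cases hj : j = i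
      · subst hj; simp; omega
      · rwa [Function.update_of_ne hj]
    have top' : TipTop a (Function.update p i (p i + 1)) h' i := by
      intro j t ht _
      by_cases hj : j = i
      · subst hj
        simp only [Function.update_self] at ht ⊢
        rcases Nat.lt_or_ge (p j) t with h1 | h1
        · obtain rfl : t = p j + 1 := by omega
          exact le_rfl
        · rw [hold j t h1]; exact (hnew j t h1).le
      · rw [Function.update_of_ne hj] at ht
        rw [Function.update_self, hold j t ht]; exact (hnew j t ht).le
    obtain ⟨h'', H'', hold', hnew'⟩ := ih H' top'
    refine ⟨h'', ?_, ?_, ?_⟩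
    · rw [Function.update_self, Function.update_idem] at H''
      rwa [show p i + (d + 1) = p i + 1 + d by omega]
    · intro j t ht
      rw [hold' j t (hle j t ht), hold j t ht]
    · intro j t s ht h1 h2
      rcases Nat.lt_or_ge (p i + 1) s with h3 | h3
      · have := hnew' j t s (hle j t ht) (by simpa using h3) (by simp; omega)
        rwa [hold j t ht] at this
      · obtain rfl : s = p i + 1 := by omega
        rw [hold' i _ (by simp)]
        exact hnew j t ht

theorem exists_of_complete (ha : GenericWalks a) (H : PlanarHeights a p h) {i j k : Fin 3} {n : ℕ}
    (hij : i ≠ j) (hik : i ≠ k) (hjk : j ≠ k) (hp : ∀ l, p l ≤ n) (hk : p k = n)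
    (top : TipTop a p h i) (bot : TipTop a p (-h) j) :
    ∃ h', PlanarHeights a (fun _ => n) h' := by
  obtain ⟨h', H', hold, hnew⟩ := exists_extend ha H top (n - p i)
  have hi : p i + (n - p i) = n := by have := hp i; omega
  rw [hi] at H' hnew
  have bot' : TipTop a (Function.update p i n) (-h') j := by
    intro l t ht e
    rw [Function.update_of_ne hij.symm] at e ⊢
    simp only [Pi.neg_apply, neg_le_neg_iff]
    rw [hold j _ le_rfl]
    by_cases hl : t ≤ p l
    · rw [hold l t hl]
      simpa using bot l t hl e
    · obtain rfl : l = i := by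
        by_contra hne
        rw [Function.update_of_ne hne] at ht
        exact hl ht
      simp only [Function.update_self] at ht
      exact (hnew j _ t le_rfl (by omega) ht).le
  obtain ⟨h'', H'', -, -⟩ := exists_extend ha H'.neg bot' (n - p j)
  refine ⟨h'', ?_⟩
  convert H'' using 1
  funext l
  have h1 := hp j
  obtain rfl | rfl | rfl : l = i ∨ l = j ∨ l = k := by omega
  · rw [Function.update_of_ne hij, Function.update_self]
  · rw [Function.update_self, Function.update_of_ne hij.symm]; omega
  · rw [Function.update_of_ne hjk.symm, Function.update_of_ne hik.symm, hk]

/-- The truncated arms lie over `[m, M]`, the tip of arm `j` is the only vertex at level `M`, the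
tip of arm `k` is the only vertex at level `m`, and the tip of arm `i` is highest at its level. -/
structure Separated (a : Fin 3 → ℕ → ℤ) (n : ℕ) (p : Fin 3 → ℕ) (h : Fin 3 → ℕ → ℤ)
    (i j k : Fin 3) (m M : ℤ) : Prop where
  planar : PlanarHeights a p h
  ne_ij : i ≠ j
  ne_ik : i ≠ k
  ne_jk : j ≠ k
  le_length : ∀ l, p l ≤ n
  lower : ∀ l t, t ≤ p l → m ≤ a l t
  upper : ∀ l t, t ≤ p l → a l t ≤ M
  pos_j : 0 < p j
  pos_k : 0 < p k
  tip_j : a j (p j) = M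
  tip_k : a k (p k) = m
  only_j : ∀ l t, t ≤ p l → a l t = M → l = j ∧ t = p j
  only_k : ∀ l t, t ≤ p l → a l t = m → l = k ∧ t = p k
  top : TipTop a p h i

theorem Separated.neg_walks {n : ℕ} {i j k : Fin 3} {m M : ℤ} (S : Separated a n p h i j k m M) :
    Separated (-a) n p h i k j (-M) (-m) where
  planar := PlanarHeights.neg_walks (by simpa using S.planar)
  ne_ij := S.ne_ik
  ne_ik := S.ne_ij
  ne_jk := S.ne_jk.symm
  le_length := S.le_length
  lower l t ht := by simpa using S.upper l t ht
  upper l t ht := by simpa using S.lower l t ht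
  pos_j := S.pos_k
  pos_k := S.pos_j
  tip_j := by simp [S.tip_k]
  tip_k := by simp [S.tip_j]
  only_j l t ht e := S.only_k l t ht (by simpa using e)
  only_k l t ht e := S.only_j l t ht (by simpa using e)
  top l t ht e := S.top l t ht (by simpa using e)

theorem forall_le_update {i : Fin 3} {P : Fin 3 → ℕ → Prop} (hP : ∀ l t, t ≤ p l → P l t)
    (hi : P i (p i + 1)) : ∀ l t, t ≤ Function.update p i (p i + 1) l → P l t := by
  intro l t ht
  by_cases hl : l = i
  · subst hl
    simp only [Function.update_self] at ht
    rcases Nat.lt_or_ge (p l) t with h1 | h1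
    · obtain rfl : t = p l + 1 := by omega
      exact hi
    · exact hP l t h1
  · rw [Function.update_of_ne hl] at ht
    exact hP l t ht

/-- If the tips of arms `i` and `j` are the highest and the lowest vertex at the top level `M`,
one of these two arms can be continued to level `M + 1`. -/
theorem exists_of_two_tops (ha : GenericWalks a) {n : ℕ} {i j k : Fin 3} {m M : ℤ}
    (H : PlanarHeights a p h) (hij : i ≠ j) (hik : i ≠ k) (hjk : j ≠ k) (hp : ∀ l, p l ≤ n)
    (lower : ∀ l t, t ≤ p l → m ≤ a l t) (upper : ∀ l t, t ≤ p l → a l t ≤ M)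
    (pos_i : 0 < p i) (pos_j : 0 < p j) (pos_k : 0 < p k)
    (tip_i : a i (p i) = M) (tip_j : a j (p j) = M) (tip_k : a k (p k) = m)
    (only_k : ∀ l t, t ≤ p l → a l t = m → l = k ∧ t = p k)
    (top : TipTop a p h i) (bot : TipTop a p (-h) j)
    (ih : ∀ p' h' i' j' M', Separated a n p' h' i' j' k m M' →
      p i + p j + p k < p' i' + p' j' + p' k → ∃ h'', PlanarHeights a (fun _ => n) h'') :
    ∃ h'', PlanarHeights a (fun _ => n) h'' := by
  have only_tip : ∀ h' : Fin 3 → ℕ → ℤ, TipTop a p h' k := by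
    intro h' l t ht e
    obtain ⟨rfl, rfl⟩ := only_k l t ht (e.trans tip_k)
    exact le_rfl
  have hmM : m < M := by
    refine lt_of_le_of_ne (tip_i ▸ lower i _ le_rfl) ?_
    rintro rfl
    exact hik (only_k i _ le_rfl tip_i).1
  -- arm `j` is continued to level `M + 1`, below everything else
  have advance : ∀ (h : Fin 3 → ℕ → ℤ) (i j : Fin 3), PlanarHeights a p h → i ≠ j → i ≠ k →
      j ≠ k → p j < n → 0 < p j → a i (p i) = M → a j (p j) = M → TipTop a p h i →
      TipTop a p (-h) j → a j (p j + 1) = M + 1 →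
      ∃ p' h', Separated a n p' h' i j k m (M + 1) ∧
        p i + p j + p k < p' i + p' j + p' k := by
    clear ih top bot tip_i tip_j pos_i pos_j H hij hik hjk
    intro h i j H hij hik hjk hjn pos_j tip_i tip_j top bot hj
    obtain ⟨h', H', hold, hnew⟩ := exists_step ha H.neg bot
    refine ⟨_, -h', ⟨H'.neg, hij, hik, hjk, ?_, ?_, ?_, ?_, ?_, ?_, ?_, ?_, ?_, ?_⟩, ?_⟩
    · intro l
      by_cases hl : l = j
      · subst hl; simpa using hjn
      · rw [Function.update_of_ne hl]; exact hp l
    · exact forall_le_update lower (by omega)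
    · exact forall_le_update (fun l t ht => (upper l t ht).trans (by omega)) (by omega)
    · simp
    · rwa [Function.update_of_ne hjk.symm]
    · simpa using hj
    · rwa [Function.update_of_ne hjk.symm]
    · refine forall_le_update (fun l t ht e => ?_) (fun _ => by simp)
      have := upper l t ht
      omega
    · rw [Function.update_of_ne hjk.symm]
      exact forall_le_update only_k (fun e => by omega)
    · unfold TipTop
      rw [Function.update_of_ne hij]
      refine forall_le_update (fun l t ht e => ?_) (fun e => by omega)
      have := top l t ht e
      simp only [Pi.neg_apply, hold l t ht, hold i _ le_rfl]
      simpa using this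
    · rw [Function.update_of_ne hij, Function.update_self, Function.update_of_ne hjk.symm]
      omega
  by_cases hi : p i = n
  · exact exists_of_complete ha H hjk.symm hik.symm hij.symm hp hi (only_tip h) bot
  by_cases hj : p j = n
  · exact exists_of_complete ha H hik hij hjk.symm hp hj top (only_tip _)
  have hi' := hp i
  have hj' := hp j
  by_cases hju : a j (p j + 1) = M + 1
  · obtain ⟨p', h', S, hlt⟩ := advance h i j H hij hik hjk (by omega) pos_j tip_i tip_j top bot hju
    exact ih p' h' i j _ S hlt
  by_cases hiu : a i (p i + 1) = M + 1
  · obtain ⟨p', h', S, hlt⟩ := advance (-h) j i H.neg hij.symm hjk hik (by omega) pos_i tip_j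
      tip_i bot (by simpa using top) hiu
    exact ih p' h' j i _ S (by omega)
  exfalso
  obtain ⟨s, hs⟩ : ∃ s, p i = s + 1 := ⟨p i - 1, by omega⟩
  obtain ⟨t, ht⟩ : ∃ t, p j = t + 1 := ⟨p j - 1, by omega⟩
  have h1 := upper i s (by omega)
  have h2 := upper j t (by omega)
  have h3 := ha.step i s
  have h4 := ha.step j t
  have h5 := ha.step i (s + 1)
  have h6 := ha.step j (t + 1)
  rw [hs] at tip_i hiu
  rw [ht] at tip_j hju
  exact ha.turn i j s t hij (show a i (s + 1 + 1) = _ by omega) (show a j (t + 1 + 1) = _ by omega)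
    (by omega)

theorem Separated.exists_planarHeights (ha : GenericWalks a) {n : ℕ} {i j k : Fin 3} {m M : ℤ}
    (S : Separated a n p h i j k m M) : ∃ h', PlanarHeights a (fun _ => n) h' := by
  obtain ⟨N, hN⟩ : ∃ N, N = 3 * n - (p i + p j + p k) := ⟨_, rfl⟩
  induction N using Nat.strong_induction_on generalizing a p h i j k m M with
  | _ N ih =>
  by_cases hi : p i = n
  · refine exists_of_complete ha S.planar S.ne_jk S.ne_ij.symm S.ne_ik.symm S.le_length hi ?_ ?_
    · intro l t ht e
      obtain ⟨rfl, rfl⟩ := S.only_j l t ht (e.trans S.tip_j)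
      exact le_rfl
    · intro l t ht e
      obtain ⟨rfl, rfl⟩ := S.only_k l t ht (e.trans S.tip_k)
      exact le_rfl
  have hin := S.le_length i
  obtain ⟨h', H', hold, hnew⟩ := exists_step ha S.planar S.top
  set p' := Function.update p i (p i + 1) with hp'
  have hpi : p' i = p i + 1 := by simp [hp']
  have hpj : p' j = p j := by rw [hp', Function.update_of_ne S.ne_ij.symm]
  have hpk : p' k = p k := by rw [hp', Function.update_of_ne S.ne_ik.symm]
  have hle : ∀ l, p' l ≤ n := by
    intro l
    by_cases hl : l = i
    · subst hl; omega
    · rw [hp', Function.update_of_ne hl]; exact S.le_length l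
  have top' : ∀ l t, t ≤ p' l → h' l t ≤ h' i (p' i) := by
    rw [hpi]
    refine forall_le_update (fun l t ht => ?_) le_rfl
    rw [hold l t ht]
    exact (hnew l t ht).le
  have hstep := ha.step i (p i)
  have h1 : m < a i (p i) := lt_of_le_of_ne (S.lower i _ le_rfl) fun e =>
    S.ne_ik (S.only_k i _ le_rfl e.symm).1
  have h2 : a i (p i) < M := lt_of_le_of_ne (S.upper i _ le_rfl) fun e =>
    S.ne_ij (S.only_j i _ le_rfl e).1
  have lower' : ∀ l t, t ≤ p' l → m ≤ a l t := forall_le_update S.lower (by omega)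
  have upper' : ∀ l t, t ≤ p' l → a l t ≤ M := forall_le_update S.upper (by omega)
  have tipj' : a j (p' j) = M := by rw [hpj, S.tip_j]
  have tipk' : a k (p' k) = m := by rw [hpk, S.tip_k]
  have onlyj' : a i (p i + 1) ≠ M → ∀ l t, t ≤ p' l → a l t = M → l = j ∧ t = p' j := by
    intro hne
    rw [hpj]
    exact forall_le_update S.only_j fun e => absurd e hne
  have onlyk' : a i (p i + 1) ≠ m → ∀ l t, t ≤ p' l → a l t = m → l = k ∧ t = p' k := by
    intro hne
    rw [hpk]
    exact forall_le_update S.only_k fun e => absurd e hne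
  have posj := S.pos_j
  have posk := S.pos_k
  have bot : ∀ l, l ≠ i → (∀ q t, t ≤ p q → a q t = a l (p l) → q = l ∧ t = p l) →
      TipTop a p' (-h') l := by
    intro l hl only
    unfold TipTop
    rw [show p' l = p l by rw [hp', Function.update_of_ne hl]]
    refine forall_le_update (fun q t ht e => ?_) (fun _ => ?_)
    · obtain ⟨rfl, rfl⟩ := only q t ht e
      exact le_rfl
    · simp only [Pi.neg_apply, neg_le_neg_iff, hold l _ le_rfl]
      exact (hnew l _ le_rfl).le
  by_cases hM : a i (p i + 1) = M
  · refine exists_of_two_tops ha H' S.ne_ij S.ne_ik S.ne_jk hle lower' upper' (by omega) (by omega)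
      (by omega) (by rw [hpi, hM]) tipj' tipk' (onlyk' (by omega)) (fun l t ht _ => top' l t ht)
      (bot j S.ne_ij.symm fun q t ht e => S.only_j q t ht (e.trans S.tip_j)) ?_
    intro q g i' j' M' S' hlt
    have := S'.le_length i'
    have := S'.le_length j'
    have := S'.le_length k
    exact ih _ (by omega) ha S' rfl
  by_cases hm : a i (p i + 1) = m
  · have key : ∃ g, PlanarHeights (-a) (fun _ => n) g := by
      refine exists_of_two_tops (k := j) (m := -M) (M := -m) ha.neg
        (PlanarHeights.neg_walks (by simpa using H')) S.ne_ik S.ne_ij S.ne_jk.symm hle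
        (fun l t ht => by simpa using upper' l t ht) (fun l t ht => by simpa using lower' l t ht)
        (by omega) (by omega) (by omega) (by simp [hpi, hm]) (by simp [tipk']) (by simp [tipj'])
        (fun l t ht e => onlyj' hM l t ht (by simpa using e)) (fun l t ht _ => top' l t ht)
        (fun l t ht e => bot k S.ne_ik.symm (fun q t ht e => S.only_k q t ht (e.trans S.tip_k))
          l t ht (by simpa using e)) ?_
      intro q g i' j' M' S' hlt
      have := S'.le_length i'
      have := S'.le_length j'
      have := S'.le_length j
      exact ih _ (by omega) ha.neg S' rfl
    obtain ⟨g, hg⟩ := key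
    exact ⟨g, hg.neg_walks⟩
  · have hjn := S.le_length j
    have hkn := S.le_length k
    exact ih _ (by omega) ha ⟨H', S.ne_ij, S.ne_ik, S.ne_jk, hle, lower', upper',
      by omega, by omega, tipj', tipk', onlyj' hM, onlyk' hm, fun l t ht _ => top' l t ht⟩ rfl

end PlanarHeights

theorem GenericWalks.exists_planarHeights {a : Fin 3 → ℕ → ℤ} (ha : GenericWalks a)
    (h1 : a 1 1 = -1) (h2 : a 2 1 = 1) {n : ℕ} (hn : 0 < n) :
    ∃ h, PlanarHeights a (fun _ => n) h := by
  have S : PlanarHeights.Separated a n ![0, 1, 1] (fun i s => if s = 0 then 0 else i)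
      0 2 1 (-1) 1 := by
    have key : ∀ (l : Fin 3) (t : ℕ), t ≤ (![0, 1, 1] : Fin 3 → ℕ) l →
        t = 0 ∨ (l = 1 ∧ t = 1) ∨ (l = 2 ∧ t = 1) := by
      intro l t ht
      fin_cases l <;> simp at ht ⊢ <;> omega
    refine ⟨⟨?_, ?_, ?_⟩, by decide, by decide, by decide, ?_, ?_, ?_, ?_, ?_, ?_, ?_, ?_, ?_, ?_⟩
    · simp
    · intro i j s t hs ht e
      rcases key i s hs with rfl | ⟨rfl, rfl⟩ | ⟨rfl, rfl⟩ <;>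
      rcases key j t ht with rfl | ⟨rfl, rfl⟩ | ⟨rfl, rfl⟩ <;> simp at e ⊢
    · intro i j s s' t t' hs hs' ht ht' es et e e' hlt
      rcases key i s hs with rfl | ⟨rfl, rfl⟩ | ⟨rfl, rfl⟩ <;>
      rcases key j t ht with rfl | ⟨rfl, rfl⟩ | ⟨rfl, rfl⟩ <;>
      simp [ha.zero, h1, h2] at e hlt
    · intro l; fin_cases l <;> simp <;> omega
    · intro l t ht
      rcases key l t ht with rfl | ⟨rfl, rfl⟩ | ⟨rfl, rfl⟩ <;> simp [ha.zero, h1, h2]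
    · intro l t ht
      rcases key l t ht with rfl | ⟨rfl, rfl⟩ | ⟨rfl, rfl⟩ <;> simp [ha.zero, h1, h2]
    · simp
    · simp
    · simpa using h2
    · simpa using h1
    · intro l t ht
      rcases key l t ht with rfl | ⟨rfl, rfl⟩ | ⟨rfl, rfl⟩ <;> simp [ha.zero, h1, h2]
    · intro l t ht
      rcases key l t ht with rfl | ⟨rfl, rfl⟩ | ⟨rfl, rfl⟩ <;> simp [ha.zero, h1, h2]
    · intro l t ht
      rcases key l t ht with rfl | ⟨rfl, rfl⟩ | ⟨rfl, rfl⟩ <;> simp [ha.zero, h1, h2]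
  exact S.exists_planarHeights ha

/-- The piecewise linear function with value `a k` at each `k ≤ n`. -/
noncomputable def interp (a : ℕ → ℤ) : ℕ → ℝ → ℝ
  | 0, _ => a 0
  | n + 1, u => interp a n u + (a (n + 1) - a n) * max 0 (min 1 (u - n))

theorem continuous_interp (a : ℕ → ℤ) (n : ℕ) : Continuous (interp a n) := by
  induction n with
  | zero => exact continuous_const
  | succ n ih =>
    simp only [interp]
    fun_prop

theorem interp_of_le (a : ℕ → ℤ) (n : ℕ) {u : ℝ} (hu : n ≤ u) : interp a n u = a n := by
  induction n with
  | zero => rfl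
  | succ n ih =>
    push_cast at hu
    rw [interp, ih (by linarith), min_eq_left (by linarith), max_eq_right zero_le_one]
    ring

theorem interp_of_mem (a : ℕ → ℤ) {n k : ℕ} (hk : k < n) {u : ℝ} (h1 : k ≤ u) (h2 : u ≤ k + 1) :
    interp a n u = a k + (u - k) * (a (k + 1) - a k) := by
  induction n with
  | zero => omega
  | succ n ih =>
    rw [interp]
    rcases Nat.lt_or_ge k n with h | h
    · have : (k : ℝ) + 1 ≤ n := by exact_mod_cast h
      rw [ih h, max_eq_left (le_trans (min_le_right _ _) (by linarith))]
      ring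
    · obtain rfl : k = n := by omega
      rw [interp_of_le a k h1, min_eq_right (by linarith), max_eq_right (by linarith)]
      ring

theorem interp_zero (a : ℕ → ℤ) (n : ℕ) : interp a n 0 = a 0 := by
  rcases Nat.eq_zero_or_pos n with rfl | h
  · rfl
  · rw [interp_of_mem a h (by simp) (by simp)]
    simp

theorem exists_nat_mem_Icc {n : ℕ} (hn : 0 < n) {u : ℝ} (hu : u ∈ Set.Icc (0 : ℝ) n) :
    ∃ k < n, (k : ℝ) ≤ u ∧ u ≤ k + 1 := by
  by_cases h : u = n
  · refine ⟨n - 1, by omega, ?_, ?_⟩ <;> rw [h, Nat.cast_sub hn] <;> simp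
  · exact ⟨⌊u⌋₊, (Nat.floor_lt hu.1).2 (lt_of_le_of_ne hu.2 h), Nat.floor_le hu.1,
      (Nat.lt_floor_add_one u).le⟩

/-- A point of a piecewise linear path lies on an edge, which is oriented so that the walk `a`
increases along it. -/
theorem exists_edge {a : ℕ → ℤ} (ha : ∀ t, a (t + 1) = a t + 1 ∨ a (t + 1) = a t - 1)
    (h : ℕ → ℤ) {n : ℕ} (hn : 0 < n) {u : ℝ} (hu : u ∈ Set.Icc (0 : ℝ) n) :
    ∃ (s s' : ℕ) (l : ℝ), s ≤ n ∧ s' ≤ n ∧ (s' = s + 1 ∨ s = s' + 1) ∧ a s' = a s + 1 ∧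
      0 ≤ l ∧ l ≤ 1 ∧ u = (1 - l) * s + l * s' ∧ interp a n u = a s + l ∧
      interp h n u = (1 - l) * h s + l * h s' := by
  obtain ⟨k, hk, h1, h2⟩ := exists_nat_mem_Icc hn hu
  rw [interp_of_mem a hk h1 h2, interp_of_mem h hk h1 h2]
  rcases ha k with hs | hs
  · refine ⟨k, k + 1, u - k, by omega, by omega, Or.inl rfl, hs, by linarith, by linarith, ?_, ?_, ?_⟩
    · push_cast; ring
    · rw [hs]; push_cast; ring
    · ring
  · refine ⟨k + 1, k, k + 1 - u, by omega, by omega, Or.inr rfl, by omega, by linarith, by linarith,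
      ?_, ?_, ?_⟩
    · push_cast; ring
    · rw [hs]; push_cast; ring
    · ring

theorem PlanarHeights.eq_of_interp_eq {a h : Fin 3 → ℕ → ℤ} {n : ℕ} (ha : GenericWalks a)
    (H : PlanarHeights a (fun _ => n) h) (hn : 0 < n) {i j : Fin 3} {u v : ℝ}
    (hu : u ∈ Set.Icc (0 : ℝ) n) (hv : v ∈ Set.Icc (0 : ℝ) n)
    (hx : interp (a i) n u = interp (a j) n v) (hy : interp (h i) n u = interp (h j) n v) :
    (i = j ∧ u = v) ∨ (u = 0 ∧ v = 0) := by
  obtain ⟨s, s', l, hs, hs', es, as, l0, l1, hul, hxl, hyl⟩ := exists_edge (ha.step i) (h i) hn hu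
  obtain ⟨t, t', m, ht, ht', et, at', m0, m1, hvm, hxm, hym⟩ := exists_edge (ha.step j) (h j) hn hv
  rw [hxl, hxm] at hx
  rw [hyl, hym] at hy
  clear hxl hxm hyl hym
  -- the case where both points are vertices
  have vertex : ∀ q r : ℕ, q ≤ n → r ≤ n → u = q → v = r → (h i q : ℝ) = h j r →
      (i = j ∧ u = v) ∨ (u = 0 ∧ v = 0) := by
    intro q r hq hr e1 e2 e
    rcases H.inj i j q r hq hr (by exact_mod_cast e) with ⟨rfl, rfl⟩ | ⟨rfl, rfl⟩
    · exact Or.inl ⟨rfl, e1.trans e2.symm⟩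
    · exact Or.inr ⟨by simpa using e1, by simpa using e2⟩
  have d1 : (a i s : ℝ) - a j t ≤ 1 := by linarith
  have d2 : (a j t : ℝ) - a i s ≤ 1 := by linarith
  have d1' : a i s - a j t ≤ 1 := by exact_mod_cast d1
  have d2' : a j t - a i s ≤ 1 := by exact_mod_cast d2
  obtain e | e | e : a i s = a j t ∨ a i s = a j t + 1 ∨ a j t = a i s + 1 := by omega
  · obtain rfl : l = m := by rw [e] at hx; linarith
    have e' : a i s' = a j t' := by omega
    rcases lt_trichotomy (h i s) (h j t) with hlt | heq | hlt
    · have hle := H.noncrossing i j s s' t t' hs hs' ht ht' es et e e' hlt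
      have hlt' : (h i s : ℝ) < h j t := by exact_mod_cast hlt
      have hle' : (h i s' : ℝ) ≤ h j t' := by exact_mod_cast hle
      have hl : l = 1 := by
        by_contra hne
        have : 0 < 1 - l := by
          have := lt_of_le_of_ne l1 hne
          linarith
        nlinarith [mul_lt_mul_of_pos_left hlt' this, mul_le_mul_of_nonneg_left hle' l0]
      subst hl
      exact vertex s' t' hs' ht' (by linarith) (by linarith) (by linarith)
    · have hmul : l * ((h i s' : ℝ) - h j t') = 0 := by rw [heq] at hy; linarith
      rcases mul_eq_zero.1 hmul with h0 | h0
      · subst h0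
        exact vertex s t hs ht (by linarith) (by linarith) (by rw [heq])
      · have h0' : h i s' = h j t' := by exact_mod_cast sub_eq_zero.1 h0
        have k1 := H.inj i j s t hs ht heq
        have k2 := H.inj i j s' t' hs' ht' h0'
        obtain ⟨rfl, rfl, rfl⟩ : i = j ∧ s = t ∧ s' = t' := by omega
        exact Or.inl ⟨rfl, by rw [hul, hvm]⟩
    · have hle := H.noncrossing j i t t' s s' ht ht' hs hs' et es e.symm e'.symm hlt
      have hlt' : (h j t : ℝ) < h i s := by exact_mod_cast hlt
      have hle' : (h j t' : ℝ) ≤ h i s' := by exact_mod_cast hle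
      have hl : l = 1 := by
        by_contra hne
        have : 0 < 1 - l := by
          have := lt_of_le_of_ne l1 hne
          linarith
        nlinarith [mul_lt_mul_of_pos_left hlt' this, mul_le_mul_of_nonneg_left hle' l0]
      subst hl
      exact vertex s' t' hs' ht' (by linarith) (by linarith) (by linarith)
  · have e' : (a i s : ℝ) = a j t + 1 := by exact_mod_cast e
    obtain rfl : l = 0 := by linarith
    obtain rfl : m = 1 := by linarith
    exact vertex s t' hs ht' (by linarith) (by linarith) (by linarith)
  · have e' : (a j t : ℝ) = a i s + 1 := by exact_mod_cast e
    obtain rfl : l = 1 := by linarith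
    obtain rfl : m = 0 := by linarith
    exact vertex s' t hs' ht (by linarith) (by linarith) (by linarith)

/-- The position and the current direction of a `±1` walk which starts in direction `d` and tracks
the sequence `c`, changing direction only at levels congruent to `r` modulo `3`. -/
noncomputable def trackingWalk (r d : ℤ) (c : ℕ → ℝ) : ℕ → ℤ × ℤ
  | 0 => (0, d)
  | t + 1 =>
    let x := trackingWalk r d c t
    let d' := if 3 ∣ x.1 - r then (if (x.1 : ℝ) ≤ c t then 1 else -1) else x.2
    (x.1 + d', d')

section trackingWalk

variable {r d : ℤ} {c : ℕ → ℝ}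

theorem trackingWalk_direction (hd : d = 1 ∨ d = -1) (t : ℕ) :
    (trackingWalk r d c t).2 = 1 ∨ (trackingWalk r d c t).2 = -1 := by
  induction t with
  | zero => exact hd
  | succ t ih =>
    simp only [trackingWalk]
    split_ifs <;> simp [ih]

theorem trackingWalk_fst_succ (t : ℕ) : (trackingWalk r d c (t + 1)).1 =
    (trackingWalk r d c t).1 + (trackingWalk r d c (t + 1)).2 := rfl

theorem trackingWalk_turn (hd : d = 1 ∨ d = -1) (t : ℕ)
    (h : (trackingWalk r d c (t + 2)).1 = (trackingWalk r d c t).1) :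
    3 ∣ (trackingWalk r d c (t + 1)).1 - r := by
  by_contra hr
  have h1 := trackingWalk_fst_succ (r := r) (d := d) (c := c) t
  have h2 := trackingWalk_fst_succ (r := r) (d := d) (c := c) (t + 1)
  have h3 := trackingWalk_direction (r := r) (c := c) hd (t + 1)
  have h4 : (trackingWalk r d c (t + 2)).2 = (trackingWalk r d c (t + 1)).2 := by
    rw [trackingWalk]
    simp only [if_neg hr]
  simp only [Nat.add_assoc, Nat.reduceAdd] at h2
  omega

theorem abs_trackingWalk_sub_le (hd : d = 1 ∨ d = -1) (hr : r = 0 ∨ r = d) (h0 : c 0 = 0)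
    (hc : ∀ t, |c (t + 1) - c t| ≤ 1 / 3) (t : ℕ) : |(trackingWalk r d c t).1 - c t| ≤ 6 := by
  -- the distance to `c` of the next level at which the walk may turn
  have key : ∃ q : ℕ, q ≤ 2 ∧
      3 ∣ (trackingWalk r d c t).1 + q * (trackingWalk r d c t).2 - r ∧
      |(trackingWalk r d c t).1 + q * (trackingWalk r d c t).2 - c t| ≤ 4 - q / 3 := by
    induction t with
    | zero =>
      rcases hr with rfl | rfl
      · exact ⟨0, by simp, by simp [trackingWalk], by simp [trackingWalk, h0]⟩
      · refine ⟨1, by simp, by simp [trackingWalk], ?_⟩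
        rcases hd with rfl | rfl <;> simp [trackingWalk, h0] <;> norm_num
    | succ t ih =>
      obtain ⟨q, hq, hdvd, hle⟩ := ih
      have hct := abs_le.1 (hc t)
      have hdir := trackingWalk_direction (r := r) (c := c) hd t
      simp only [trackingWalk]
      set x := trackingWalk r d c t
      rw [abs_le] at hle
      obtain rfl | ⟨q, rfl⟩ : q = 0 ∨ ∃ q', q = q' + 1 := by
        rcases q with _ | q
        · exact Or.inl rfl
        · exact Or.inr ⟨q, rfl⟩
      · simp only [Nat.cast_zero, zero_mul, add_zero] at hdvd hle
        refine ⟨2, le_rfl, ?_, ?_⟩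
        · rw [if_pos hdvd]
          split_ifs <;> push_cast <;> omega
        · rw [if_pos hdvd, abs_le]
          split_ifs with hx <;> push_cast <;> constructor <;> linarith
      · have hnd : ¬ 3 ∣ x.1 - r := by
          push_cast at hdvd
          obtain rfl | rfl : q = 0 ∨ q = 1 := by omega
          all_goals rcases hdir with e | e <;> rw [e] at hdvd <;> push_cast at hdvd <;> omega
        refine ⟨q, by omega, ?_, ?_⟩
        · rw [if_neg hnd]
          convert hdvd using 1
          push_cast; ring
        · rw [if_neg hnd, abs_le]
          push_cast at hle ⊢
          constructor <;> linarith
  obtain ⟨q, hq, -, hle⟩ := key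
  have hq' : (q : ℝ) ≤ 2 := by exact_mod_cast hq
  have hq0 : (0 : ℝ) ≤ q := Nat.cast_nonneg q
  rw [abs_le] at hle ⊢
  rcases trackingWalk_direction (r := r) (c := c) hd t with e | e <;> rw [e] at hle <;>
    push_cast at hle <;> constructor <;> linarith

end trackingWalk

theorem exists_genericWalks {c : Fin 3 → ℕ → ℝ} (h0 : ∀ i, c i 0 = 0)
    (hc : ∀ i t, |c i (t + 1) - c i t| ≤ 1 / 3) :
    ∃ a, GenericWalks a ∧ a 1 1 = -1 ∧ a 2 1 = 1 ∧ ∀ i t, |a i t - c i t| ≤ 6 := by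
  set r : Fin 3 → ℤ := ![0, -1, 1] with hr
  set d : Fin 3 → ℤ := ![1, -1, 1] with hd
  have hd' : ∀ i, d i = 1 ∨ d i = -1 := by decide
  have hr' : ∀ i, r i = 0 ∨ r i = d i := by decide
  have hrr : ∀ i j, i ≠ j → ¬ 3 ∣ r i - r j := by decide
  refine ⟨fun i t => (trackingWalk (r i) (d i) (c i) t).1, ⟨fun i => rfl, fun i t => ?_, ?_⟩, ?_, ?_,
    fun i t => abs_trackingWalk_sub_le (hd' i) (hr' i) (h0 i) (hc i) t⟩
  · have h1 := trackingWalk_fst_succ (r := r i) (d := d i) (c := c i) t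
    have h2 := trackingWalk_direction (r := r i) (c := c i) (hd' i) (t + 1)
    omega
  · intro i j s t hij h1 h2 h3
    have h4 := trackingWalk_turn (hd' i) s h1
    have h5 := trackingWalk_turn (hd' j) t h2
    have h6 := hrr i j hij
    omega
  · simp [trackingWalk, hr, hd]
  · simp [trackingWalk, hr, hd]

theorem exists_disjoint_arms_near {γ : Fin 3 → ℝ → ℝ} (hγ : ∀ i, UniformContinuous (γ i)) {x₀ : ℝ}
    (h0 : ∀ i, γ i 0 = x₀) {ε : ℝ} (hε : 0 < ε) :
    ∃ F : Fin 3 → ℝ → ℝ × ℝ, (∀ i, Continuous (F i)) ∧ (∀ i j, F i 0 = F j 0) ∧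
      (∀ i j, ∀ u ∈ Set.Icc (0 : ℝ) 1, ∀ v ∈ Set.Icc (0 : ℝ) 1, F i u = F j v →
        (i = j ∧ u = v) ∨ (u = 0 ∧ v = 0)) ∧
      ∀ i, ∀ u ∈ Set.Icc (0 : ℝ) 1, dist (F i u) (γ i u, 0) < ε := by
  set δ : ℝ := ε / 8 with hδ
  have hδ0 : 0 < δ := by positivity
  obtain ⟨n, hn, hclose⟩ : ∃ n : ℕ, 0 < n ∧
      ∀ i, ∀ u v : ℝ, |u - v| ≤ 1 / n → |γ i u - γ i v| ≤ δ / 3 := by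
    have hex : ∀ i, ∃ η > 0, ∀ u v : ℝ, |u - v| < η → |γ i u - γ i v| < δ / 3 := by
      intro i
      obtain ⟨η, h1, h2⟩ := Metric.uniformContinuous_iff.1 (hγ i) (δ / 3) (by positivity)
      exact ⟨η, h1, fun u v huv => h2 huv⟩
    choose η hη hηγ using hex
    obtain ⟨n, hn⟩ := exists_nat_one_div_lt (lt_min (hη 0) (lt_min (hη 1) (hη 2)))
    refine ⟨n + 1, n.succ_pos, fun i u v huv => (hηγ i u v (lt_of_le_of_lt huv ?_)).le⟩
    rw [lt_min_iff, lt_min_iff] at hn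
    push_cast
    fin_cases i
    · exact hn.1
    · exact hn.2.1
    · exact hn.2.2
  have hn0 : (0 : ℝ) < n := by exact_mod_cast hn
  obtain ⟨a, ha, ha1, ha2, hac⟩ := exists_genericWalks
    (c := fun i t => (γ i (t / n) - x₀) / δ) (fun i => by simp [h0]) (fun i t => by
      have := hclose i ((t + 1 : ℕ) / n) (t / n) (le_of_eq (by
        rw [← sub_div, abs_of_nonneg] <;> push_cast <;> simp))
      rw [← sub_div, abs_div, abs_of_pos hδ0, div_le_iff₀ hδ0]
      simpa [div_eq_inv_mul] using this)
  obtain ⟨h, H⟩ := ha.exists_planarHeights ha1 ha2 hn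
  obtain ⟨B, hB⟩ : ∃ B : ℝ, ∀ i, ∀ u ∈ Set.Icc (0 : ℝ) n, |interp (h i) n u| ≤ B := by
    have hex : ∀ i, ∃ C, ∀ u ∈ Set.Icc (0 : ℝ) n, ‖interp (h i) n u‖ ≤ C := fun i =>
      isCompact_Icc.exists_bound_of_continuousOn (continuous_interp (h i) n).continuousOn
    choose C hC using hex
    exact ⟨∑ i, |C i|, fun i u hu => (hC i u hu).trans ((le_abs_self _).trans
      (Finset.single_le_sum (f := fun i => |C i|) (fun _ _ => abs_nonneg _) (Finset.mem_univ i)))⟩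
  have hB0 : 0 ≤ B := (abs_nonneg _).trans (hB 0 0 ⟨le_rfl, hn0.le⟩)
  set κ : ℝ := ε / (B + 1) with hκ
  have hκ0 : 0 < κ := by positivity
  have hmem : ∀ u ∈ Set.Icc (0 : ℝ) 1, n * u ∈ Set.Icc (0 : ℝ) n := fun u hu =>
    ⟨mul_nonneg hn0.le hu.1, by nlinarith [hu.2]⟩
  refine ⟨fun i u => (x₀ + δ * interp (a i) n (n * u), κ * interp (h i) n (n * u)), ?_, ?_, ?_, ?_⟩
  · intro i
    have h1 := continuous_interp (a i) n
    have h2 := continuous_interp (h i) n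
    fun_prop
  · intro i j
    simp [interp_zero, ha.zero, H.zero]
  · intro i j u hu v hv e
    simp only [Prod.mk.injEq, add_right_inj, mul_eq_mul_left_iff, hδ0.ne', hκ0.ne', or_false] at e
    rcases H.eq_of_interp_eq ha hn (hmem u hu) (hmem v hv) e.1 e.2 with ⟨h1, h2⟩ | ⟨h1, h2⟩
    · exact Or.inl ⟨h1, mul_left_cancel₀ hn0.ne' h2⟩
    · exact Or.inr ⟨(mul_eq_zero.1 h1).resolve_left hn0.ne',
        (mul_eq_zero.1 h2).resolve_left hn0.ne'⟩
  · intro i u hu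
    rw [Prod.dist_eq, max_lt_iff, Real.dist_eq, Real.dist_eq]
    constructor
    · obtain ⟨k, hk, k1, k2⟩ := exists_nat_mem_Icc hn (hmem u hu)
      have e1 := abs_le.1 (hac i k)
      have e2 := abs_le.1 (hclose i (k / n) u (by
        rw [abs_le]
        constructor
        · rw [neg_le_sub_iff_le_add, ← add_div, le_div_iff₀ hn0]; linarith
        · have : (k : ℝ) / n ≤ u := by rw [div_le_iff₀ hn0]; linarith
          have : 0 < 1 / (n : ℝ) := by positivity
          linarith))
      have e3 : |interp (a i) n (n * u) - a i k| ≤ 1 := by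
        rw [interp_of_mem _ hk k1 k2, abs_le]
        rcases ha.step i k with e | e <;> rw [e] <;> push_cast <;> constructor <;> linarith
      have e4 : δ * ((γ i (k / n) - x₀) / δ) = γ i (k / n) - x₀ := mul_div_cancel₀ _ hδ0.ne'
      rw [abs_le] at e3
      have e5 := mul_le_mul_of_nonneg_left e1.1 hδ0.le
      have e6 := mul_le_mul_of_nonneg_left e1.2 hδ0.le
      have e7 := mul_le_mul_of_nonneg_left e3.1 hδ0.le
      have e8 := mul_le_mul_of_nonneg_left e3.2 hδ0.le
      rw [mul_sub, e4] at e5 e6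
      rw [mul_sub] at e7 e8
      have : ε = 8 * δ := by rw [hδ]; ring
      simp only
      rw [abs_lt]
      constructor <;> linarith
    · simp only [sub_zero]
      rw [abs_mul, abs_of_pos hκ0, hκ, div_mul_eq_mul_div, div_lt_iff₀ (by positivity)]
      exact mul_lt_mul_of_pos_left (by linarith [hB i _ (hmem u hu)]) hε

/-- The three arms of the triod. -/
def triodArm : Fin 3 → ℝ → ℝ × ℝ
  | 0, u => (-u, 0)
  | 1, u => (u, 0)
  | 2, u => (0, u)

theorem continuous_triodArm (i : Fin 3) : Continuous (triodArm i) := by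
  fin_cases i
  · exact continuous_neg.prodMk continuous_const
  · exact continuous_id.prodMk continuous_const
  · exact continuous_const.prodMk continuous_id

theorem mem_triod_iff {x : ℝ × ℝ} :
    x ∈ (Set.Icc (-1 : ℝ) 1 ×ˢ ({0} : Set ℝ)) ∪ (({0} : Set ℝ) ×ˢ Set.Icc (0 : ℝ) 1) ↔
      ∃ i, ∃ u ∈ Set.Icc (0 : ℝ) 1, triodArm i u = x := by
  obtain ⟨x, y⟩ := x
  simp only [Set.mem_union, Set.mem_prod, Set.mem_Icc, Set.mem_singleton_iff]
  constructor
  · rintro (⟨⟨h1, h2⟩, rfl⟩ | ⟨rfl, h1, h2⟩)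
    · rcases le_total x 0 with hx | hx
      · exact ⟨0, -x, ⟨by linarith, by linarith⟩, by simp [triodArm]⟩
      · exact ⟨1, x, ⟨hx, h2⟩, rfl⟩
    · exact ⟨2, y, ⟨h1, h2⟩, rfl⟩
  · rintro ⟨i, u, ⟨h1, h2⟩, e⟩
    fin_cases i <;> simp only [triodArm, Prod.mk.injEq] at e <;> obtain ⟨rfl, rfl⟩ := e
    · exact Or.inl ⟨⟨by linarith, by linarith⟩, rfl⟩
    · exact Or.inl ⟨⟨by linarith, by linarith⟩, rfl⟩
    · exact Or.inr ⟨rfl, h1, h2⟩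

/-- Sieklucki, 1969: Every continuous map of the triod
T = ([-1,1] × {0}) ∪ ({0} × [0,1]) into the plane whose range lies in the segment
[0,1] × {0} is approximable by embeddings. -/
theorem stmt_2
    (T : Set (ℝ × ℝ))
    (hT : T = (Set.Icc (-1 : ℝ) 1 ×ˢ ({0} : Set ℝ)) ∪ (({0} : Set ℝ) ×ˢ Set.Icc (0 : ℝ) 1))
    (φ : T → ℝ × ℝ) (hφ : Continuous φ)
    (hrange : Set.range φ ⊆ Set.Icc (0 : ℝ) 1 ×ˢ ({0} : Set ℝ)) :
    ∀ ε > (0 : ℝ), ∃ f : T → ℝ × ℝ,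
      Continuous f ∧ Function.Injective f ∧ ∀ x, dist (f x) (φ x) < ε := by
  intro ε hε
  have hmem : ∀ x, x ∈ T ↔ ∃ i, ∃ u ∈ Set.Icc (0 : ℝ) 1, triodArm i u = x := by
    intro x
    rw [hT, mem_triod_iff]
  let arm (i : Fin 3) (u : Set.Icc (0 : ℝ) 1) : T := ⟨triodArm i u, (hmem _).2 ⟨i, u, u.2, rfl⟩⟩
  have harm : ∀ i, Continuous (arm i) := fun i =>
    ((continuous_triodArm i).comp continuous_subtype_val).subtype_mk _
  let γ (i : Fin 3) (u : ℝ) : ℝ := (φ (arm i (Set.projIcc 0 1 zero_le_one u))).1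
  have hγ : ∀ i, UniformContinuous (γ i) := fun i =>
    (CompactSpace.uniformContinuous_of_continuous (continuous_fst.comp (hφ.comp (harm i)))).comp
      (LipschitzWith.projIcc zero_le_one).uniformContinuous
  have hγ0 : ∀ i, γ i 0 = (φ ⟨0, (hmem _).2 ⟨1, 0, by simp, rfl⟩⟩).1 := by
    intro i
    have : arm i (Set.projIcc 0 1 zero_le_one 0) = ⟨0, (hmem _).2 ⟨1, 0, by simp, rfl⟩⟩ := by
      apply Subtype.ext
      fin_cases i <;> simp [arm, triodArm]
    simp only [γ, this]
  obtain ⟨F, hF, hF0, hinj, hdist⟩ := exists_disjoint_arms_near hγ hγ0 hε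
  let G (x : ℝ × ℝ) : ℝ × ℝ :=
    F 0 (max (-x.1) 0) + F 1 (max x.1 0) + F 2 x.2 - F 0 0 - F 0 0
  have hG : Continuous G := by
    have h1 := hF 0
    have h2 := hF 1
    have h3 := hF 2
    fun_prop
  have hGF : ∀ i, ∀ u ∈ Set.Icc (0 : ℝ) 1, G (triodArm i u) = F i u := by
    intro i u hu
    have h1 := hF0 1 0
    have h2 := hF0 2 0
    fin_cases i
    · simp [G, triodArm, hu.1, h1, h2]
    · simp [G, triodArm, hu.1, h2]
    · simp only [Fin.reduceFinMk, G, triodArm, neg_zero, max_self, h1]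
      abel
  refine ⟨fun x => G x, hG.comp continuous_subtype_val, ?_, ?_⟩
  · rintro ⟨x, hx⟩ ⟨y, hy⟩ e
    obtain ⟨i, u, hu, rfl⟩ := (hmem x).1 hx
    obtain ⟨j, v, hv, rfl⟩ := (hmem y).1 hy
    simp only [hGF i u hu, hGF j v hv] at e
    apply Subtype.ext
    rcases hinj i j u hu v hv e with ⟨rfl, rfl⟩ | ⟨rfl, rfl⟩
    · rfl
    · fin_cases i <;> fin_cases j <;> simp [triodArm]
  · rintro ⟨x, hx⟩
    obtain ⟨i, u, hu, rfl⟩ := (hmem x).1 hx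
    have hval : φ ⟨triodArm i u, hx⟩ = (γ i u, 0) := by
      refine Prod.ext ?_ (hrange ⟨_, rfl⟩).2
      simp only [γ, arm, Set.projIcc_of_mem zero_le_one hu]
    simp only [hGF i u hu, hval]
    exact hdist i u hu
end

section
/- (Sieklucki, 1969) A continuous map φ : S¹ → S¹ ⊂ ℂ ≅ ℝ², regarded as a map into the plane, is approximable by embeddings if and only if its degree lies in {-1, 0, 1}, i.e., if and only if φ is homotopic, as a map S¹ → S¹, to the identity z ↦ z, to the inversion z ↦ z⁻¹, or to a constant map. -/
open scoped unitInterval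

/-- A map into the circle that differs from another by the exponential of a real function is
homotopic to it. -/
theorem Circle.homotopic_of_eq_mul_exp {X : Type*} [TopologicalSpace X] {φ ψ : C(X, Circle)}
    {g : C(X, ℝ)} (h : ∀ x, φ x = ψ x * Circle.exp (g x)) : φ.Homotopic ψ := by
  refine ContinuousMap.Homotopic.symm
    ⟨⟨⟨fun p : I × X => ψ p.2 * Circle.exp (p.1 * g p.2), by fun_prop⟩, fun x => ?_, fun x => ?_⟩⟩
  · simp
  · simp [h x]

/-- Homotopic maps into the circle differ by the exponential of a real function. -/
theorem Circle.exists_eq_mul_exp_of_homotopic {X : Type*} [TopologicalSpace X]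
    {φ ψ : C(X, Circle)} (h : φ.Homotopic ψ) :
    ∃ g : C(X, ℝ), ∀ x, φ x = ψ x * Circle.exp (g x) := by
  obtain ⟨H⟩ := h.symm
  let K : C(I × X, Circle) := ⟨fun p => H p / ψ p.2, by fun_prop⟩
  have hK : ∀ x, K (0, x) = Circle.exp ((0 : C(X, ℝ)) x) := fun x => by simp [K]
  let L := Circle.isCoveringMap_exp.liftHomotopy K 0 hK
  refine ⟨⟨fun x => L (1, x), by fun_prop⟩, fun x => ?_⟩
  have := congrFun (Circle.isCoveringMap_exp.liftHomotopy_lifts K 0 hK) (1, x)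
  have h' : Circle.exp (L (1, x)) = φ x / ψ x := this.trans (by simp [K])
  simp [h']

/-- A continuous periodic function on the line descends to the circle. -/
theorem Circle.exists_comp_exp_eq_of_periodic {Y : Type*} [TopologicalSpace Y] {F : ℝ → Y}
    (hF : Continuous F) (hp : Function.Periodic F (2 * Real.pi)) :
    ∃ g : C(Circle, Y), ∀ t, g (Circle.exp t) = F t := by
  let k : C(AddCircle (2 * Real.pi), Y) := ⟨hp.lift, continuous_coinduced_dom.mpr hF⟩
  refine ⟨k.comp (AddCircle.homeomorphCircle'.symm : C(Circle, AddCircle (2 * Real.pi))),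
    fun t => ?_⟩
  rw [← AddCircle.homeomorphCircle'_apply_mk]
  simp [k]

/-- A continuous real function with values in `2πℤ` is constant. -/
theorem Continuous.eq_of_exp_eq_one {F : ℝ → ℝ} (hF : Continuous F)
    (h : ∀ t, Circle.exp (F t) = 1) (s t : ℝ) : F s = F t :=
  Circle.isCoveringMap_exp.const_of_comp hF (fun _ _ => by simp only [h]) s t

/-- Every self-map of the circle is a power map up to the exponential of a real function. -/
theorem Circle.exists_eq_zpow_mul_exp (φ : C(Circle, Circle)) :
    ∃ (n : ℤ) (g : C(Circle, ℝ)), ∀ z, φ z = z ^ n * Circle.exp (g z) := by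
  obtain ⟨F, ⟨-, hF⟩, -⟩ := Circle.isCoveringMap_exp.existsUnique_continuousMap_lifts
    (φ.comp Circle.exp) 0 (Complex.arg (φ 1)) (by simp [Circle.exp_arg])
  have hF' (t : ℝ) : Circle.exp (F t) = φ (Circle.exp t) := congrFun hF t
  have hd (t : ℝ) : Circle.exp (F (t + 2 * Real.pi) - F t) = 1 := by
    simp [Circle.exp_sub, hF']
  obtain ⟨n, hn⟩ := Circle.exp_eq_one.1 (hd 0)
  have hstep (t : ℝ) : F (t + 2 * Real.pi) - F t = n * (2 * Real.pi) := by
    rw [← hn]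
    exact Continuous.eq_of_exp_eq_one (F := fun t => F (t + 2 * Real.pi) - F t)
      (by fun_prop) hd t 0
  obtain ⟨g, hg⟩ := Circle.exists_comp_exp_eq_of_periodic (F := fun t => F t - n * t)
    (by fun_prop) (fun t => by have := hstep t; simp only; linarith)
  refine ⟨n, g, fun z => ?_⟩
  obtain ⟨t, rfl⟩ := Circle.exp_surjective z
  simp [hg, hF', Circle.exp_sub]

/-- The identity of the circle is not null-homotopic. -/
theorem Circle.not_homotopic_id_const (c : Circle) :
    ¬ (ContinuousMap.id Circle).Homotopic (ContinuousMap.const Circle c) := by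
  intro h
  obtain ⟨g, hg⟩ := Circle.exists_eq_mul_exp_of_homotopic h
  have hc (t : ℝ) : Circle.exp t = c * Circle.exp (g (Circle.exp t)) := hg _
  have key := Continuous.eq_of_exp_eq_one
    (F := fun t => (t - g (Circle.exp t)) - (0 - g (Circle.exp 0))) (by fun_prop)
    (fun t => by
      have hd (s : ℝ) : Circle.exp (s - g (Circle.exp s)) = c := by
        rw [Circle.exp_sub, div_eq_iff_eq_mul]
        exact hc s
      rw [Circle.exp_sub, hd, hd, div_self']) (2 * Real.pi) 0
  simp [Real.pi_ne_zero] at key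

/-- The radial projection of a nowhere vanishing complex function to the circle. -/
noncomputable def ContinuousMap.toCircle {X : Type*} [TopologicalSpace X] (f : C(X, ℂ))
    (hf : ∀ x, f x ≠ 0) : C(X, Circle) where
  toFun x := ⟨f x / ‖f x‖, by simp [Submonoid.unitSphere, hf x]⟩
  continuous_toFun := by
    refine Continuous.subtype_mk ?_ _
    exact f.continuous.div (by fun_prop) (by simpa using hf)

/-- The value of the radial projection of a function to the circle. -/
theorem ContinuousMap.coe_toCircle_apply {X : Type*} [TopologicalSpace X] (f : C(X, ℂ))
    (hf : ∀ x, f x ≠ 0) (x : X) : (f.toCircle hf x : ℂ) = f x / ‖f x‖ := rfl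

/-- A homotopy through nowhere vanishing functions projects to a homotopy of maps to the circle. -/
theorem ContinuousMap.homotopic_toCircle {X : Type*} [TopologicalSpace X] {f₀ f₁ : C(X, ℂ)}
    (hf₀ : ∀ x, f₀ x ≠ 0) (hf₁ : ∀ x, f₁ x ≠ 0) {H : I × X → ℂ} (hc : Continuous H)
    (hH : ∀ t x, H (t, x) ≠ 0) (h₀ : ∀ x, H (0, x) = f₀ x) (h₁ : ∀ x, H (1, x) = f₁ x) :
    (f₀.toCircle hf₀).Homotopic (f₁.toCircle hf₁) := by
  obtain ⟨K, hK⟩ : ∃ K : C(I × X, ℂ), ∀ p, K p = H p := ⟨⟨H, hc⟩, fun _ => rfl⟩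
  refine ⟨⟨K.toCircle fun p => hK p ▸ hH p.1 p.2, fun x => Circle.ext ?_, fun x => Circle.ext ?_⟩⟩
  · change (K.toCircle _ (0, x) : ℂ) = _
    simp only [ContinuousMap.coe_toCircle_apply, hK, h₀]
  · change (K.toCircle _ (1, x) : ℂ) = _
    simp only [ContinuousMap.coe_toCircle_apply, hK, h₁]

/-- An injective map from the circle to the punctured plane has winding number `-1`, `0` or `1`. -/
theorem Circle.not_injective_zpow_mul_exp {n : ℤ} (h0 : n ≠ 0) (h1 : n ≠ 1) (h2 : n ≠ -1)
    (G : C(Circle, ℂ)) :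
    ¬ Function.Injective fun z : Circle => (z : ℂ) ^ n * Complex.exp (G z) := by
  intro hinj
  have hn : (n : ℂ) ≠ 0 := by exact_mod_cast h0
  set r : C(Circle, ℂ) := ⟨fun z => z * Complex.exp (G z / n), by fun_prop⟩ with hr
  set ω : ℂ := Complex.exp (2 * Real.pi * Complex.I / n) with hω
  have hωn : ω ^ n = 1 := by
    rw [hω, ← Complex.exp_int_mul, mul_div_cancel₀ _ hn, Complex.exp_two_pi_mul_I]
  have hω1 : ω ≠ 1 := by
    intro h
    obtain ⟨k, hk⟩ := Complex.exp_eq_one_iff.1 h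
    rw [div_eq_iff hn] at hk
    have hkn : (1 : ℂ) = k * n := by
      apply mul_right_cancel₀ Complex.two_pi_I_ne_zero
      linear_combination hk
    have hkn' : k * n = 1 := by exact_mod_cast hkn.symm
    rcases Int.isUnit_iff.1 (IsUnit.of_mul_eq_one_right _ hkn') with h | h <;> contradiction
  have hωnorm : ‖ω‖ = 1 := by
    rw [hω, Complex.norm_exp]
    simp [Complex.div_re]
  have hr0 (z : Circle) : r z ≠ 0 := mul_ne_zero z.coe_ne_zero (Complex.exp_ne_zero _)
  have hrn (z : Circle) : r z ^ n = (z : ℂ) ^ n * Complex.exp (G z) := by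
    simp only [hr, ContinuousMap.coe_mk, mul_zpow, ← Complex.exp_int_mul, mul_div_cancel₀ _ hn]
  have hD (z w : Circle) : r z - ω * r w ≠ 0 := by
    intro h
    have h' := sub_eq_zero.1 h
    have hzw : z = w := hinj <| by
      simp only [← hrn, h', mul_zpow, hωn, one_mul]
    subst hzw
    exact hω1 (mul_right_cancel₀ (hr0 z) (by rw [one_mul, ← h']))
  obtain ⟨p, -, hp⟩ := isCompact_univ.exists_isMaxOn Set.univ_nonempty
    (f := fun z => ‖r z‖) (by fun_prop)
  obtain ⟨q, -, hq⟩ := isCompact_univ.exists_isMinOn Set.univ_nonempty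
    (f := fun z => ‖r z‖) (by fun_prop)
  have hp' (z : Circle) : ‖r z‖ ≤ ‖r p‖ := hp (Set.mem_univ z)
  have hq' (z : Circle) : ‖r q‖ ≤ ‖r z‖ := hq (Set.mem_univ z)
  let d (w : Circle) : C(Circle, ℂ) := ⟨fun z => r z - ω * r w, by fun_prop⟩
  have hωp : -(ω * r p) ≠ 0 := neg_ne_zero.2 (mul_ne_zero (Complex.exp_ne_zero _) (hr0 p))
  have hA : ((ContinuousMap.const Circle (-(ω * r p))).toCircle fun _ => hωp).Homotopic
      ((d p).toCircle fun z => hD z p) := by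
    refine ContinuousMap.homotopic_toCircle _ _
      (H := fun x : I × Circle => (x.1 : ℝ) * r x.2 - ω * r p) (by fun_prop) (fun t z h => ?_)
      (by simp) (by simp [d])
    have hn := congrArg norm (sub_eq_zero.1 h)
    simp only [norm_mul, hωnorm, one_mul, Complex.norm_real, Real.norm_of_nonneg t.2.1] at hn
    have hz := norm_pos_iff.2 (hr0 z)
    have ht : (t : ℝ) = 1 := by
      refine le_antisymm t.2.2 ?_
      have := hp' z
      nlinarith
    refine hD z p ?_
    simpa [ht] using h
  have hB : ((d p).toCircle fun z => hD z p).Homotopic ((d q).toCircle fun z => hD z q) :=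
    ContinuousMap.homotopic_toCircle _ _
      (H := fun x : I × Circle => r x.2 - ω * r (Circle.path p q x.1)) (by fun_prop)
      (fun t z => hD z _) (by simp [d]) (by simp [d])
  have hC : (r.toCircle hr0).Homotopic ((d q).toCircle fun z => hD z q) := by
    refine ContinuousMap.homotopic_toCircle _ _
      (H := fun x : I × Circle => r x.2 - (x.1 : ℝ) * (ω * r q)) (by fun_prop) (fun t z h => ?_)
      (by simp) (by simp [d])
    have hn := congrArg norm (sub_eq_zero.1 h)
    simp only [norm_mul, hωnorm, one_mul, Complex.norm_real, Real.norm_of_nonneg t.2.1] at hn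
    have hz := norm_pos_iff.2 (hr0 q)
    have ht : (t : ℝ) = 1 := by
      refine le_antisymm t.2.2 ?_
      have := hq' z
      nlinarith
    refine hD z q ?_
    simpa [ht] using h
  obtain ⟨i, hi⟩ : ∃ i : C(Circle, ℂ), ∀ z : Circle, i z = z :=
    ⟨⟨fun z => z, by fun_prop⟩, fun _ => rfl⟩
  have hi0 (z : Circle) : i z ≠ 0 := hi z ▸ z.coe_ne_zero
  have hid : i.toCircle hi0 = ContinuousMap.id Circle :=
    ContinuousMap.ext fun z => Circle.ext
      (by simp [ContinuousMap.coe_toCircle_apply, hi, Circle.norm_coe])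
  have hE : (i.toCircle hi0).Homotopic (r.toCircle hr0) :=
    ContinuousMap.homotopic_toCircle _ _
      (H := fun x : I × Circle => x.2 * Complex.exp ((x.1 : ℝ) * (G x.2 / n))) (by fun_prop)
      (fun t z => mul_ne_zero z.coe_ne_zero (Complex.exp_ne_zero _)) (by simp [hi]) (by simp [hr])
  rw [hid] at hE
  have hconst : (ContinuousMap.const Circle (-(ω * r p))).toCircle (fun _ => hωp) =
      ContinuousMap.const Circle
        ((ContinuousMap.const Circle (-(ω * r p))).toCircle (fun _ => hωp) 1) :=
    ContinuousMap.ext fun _ => rfl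
  rw [hconst] at hA
  exact Circle.not_homotopic_id_const _ (((hE.trans hC).trans hB.symm).trans hA.symm)

/-- Two points of the unit circle on a line through the point `(q, 0)` outside the disc lie on
different sides of the polar line of that point. -/
theorem mul_sub_one_mul_neg_of_collinear {q x y x' y' : ℝ} (hq : 1 < q) (h : x ^ 2 + y ^ 2 = 1)
    (h' : x' ^ 2 + y' ^ 2 = 1) (hl : y * (q - x') = y' * (q - x)) (hne : x ≠ x') :
    (q * x - 1) * (q * x' - 1) < 0 := by
  have hsq : (1 - x ^ 2) * (q - x') ^ 2 = (1 - x' ^ 2) * (q - x) ^ 2 := by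
    linear_combination (y * (q - x') + y' * (q - x)) * hl - (q - x') ^ 2 * h + (q - x) ^ 2 * h'
  have hs : (x + x') * (1 + q ^ 2) = 2 * q * (1 + x * x') := by
    apply mul_left_cancel₀ (sub_ne_zero.2 hne)
    linear_combination -hsq
  have hpos : 0 < (x - x') ^ 2 := by positivity [sub_ne_zero.2 hne]
  have hx : x ≤ 1 := by nlinarith [sq_nonneg y]
  have hx' : x' ≤ 1 := by nlinarith [sq_nonneg y']
  have hsum : q * (x + x') < 2 := by
    by_contra! hcon
    nlinarith [mul_nonneg (sub_nonneg.2 hcon) (show 0 ≤ 2 * q - (x + x') by linarith)]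
  nlinarith [mul_pos (show 0 < q ^ 2 - 1 by nlinarith) (sub_pos.2 hsum)]

/-- A real function on the circle with maximum at `1` is approximated by the first coordinate of an
injective map to the plane. -/
theorem Circle.exists_injective_approx_of_max_one (g : C(Circle, ℝ)) (hg : ∀ z, g z ≤ g 1)
    {ε : ℝ} (hε : 0 < ε) :
    ∃ G u : C(Circle, ℝ), (∀ z, |G z - g z| ≤ 2 * ε) ∧
      ∀ z w, G z = G w → u z = u w → z = w := by
  obtain ⟨δ, hδ, hgδ⟩ := Metric.continuous_iff.1 g.continuous 1 ε hε
  obtain ⟨q, hq, hqδ⟩ : ∃ q : ℝ, 1 < q ∧ 2 * (q - 1) < δ ^ 2 :=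
    ⟨1 + δ ^ 2 / 4, by linarith [pow_pos hδ 2], by linarith [pow_pos hδ 2]⟩
  have hsq (z : Circle) : (z : ℂ).re ^ 2 + (z : ℂ).im ^ 2 = 1 := by
    have := z.normSq_coe
    rw [Complex.normSq_apply] at this
    linarith
  have hre (z : Circle) : |(z : ℂ).re| ≤ 1 := by
    simpa [Circle.norm_coe] using Complex.abs_re_le_norm (z : ℂ)
  have hqz (z : Circle) : 0 < q - (z : ℂ).re := by linarith [(abs_le.1 (hre z)).2]
  have hnear (z : Circle) (hz : 1 < q * (z : ℂ).re) : g 1 - ε < g z := by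
    have hd : dist z 1 < δ := by
      apply lt_of_pow_lt_pow_left₀ 2 hδ.le
      change dist (z : ℂ) ((1 : Circle) : ℂ) ^ 2 < _
      rw [Complex.dist_eq, ← Complex.normSq_eq_norm_sq, Complex.normSq_apply]
      simp only [Circle.coe_one, Complex.sub_re, Complex.sub_im, Complex.one_re, Complex.one_im]
      nlinarith [hsq z, (abs_le.1 (hre z)).2]
    linarith [(abs_lt.1 (hgδ z hd)).1]
  let G : C(Circle, ℝ) := ⟨fun z => min (g z) (g 1 - ε) + ε * (z : ℂ).re, by fun_prop⟩
  let u : C(Circle, ℝ) := ⟨fun z => (z : ℂ).im / (q - (z : ℂ).re), by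
    refine Continuous.div (by fun_prop) (by fun_prop) fun z => (hqz z).ne'⟩
  have hGlt (z w : Circle) (hz : 1 < q * (z : ℂ).re) (hw : q * (w : ℂ).re < 1) : G w < G z := by
    have h1 : (w : ℂ).re < (z : ℂ).re := by nlinarith
    have h2 : min (g z) (g 1 - ε) = g 1 - ε := min_eq_right (hnear z hz).le
    have h3 : min (g w) (g 1 - ε) ≤ g 1 - ε := min_le_right _ _
    simp only [G, ContinuousMap.coe_mk, h2]
    nlinarith
  refine ⟨G, u, fun z => ?_, fun z w hG hu => ?_⟩
  · have h1 := abs_le.1 (hre z)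
    simp only [G, ContinuousMap.coe_mk]
    rw [abs_le]
    rcases min_cases (g z) (g 1 - ε) with ⟨h, h'⟩ | ⟨h, h'⟩ <;> rw [h] <;>
      constructor <;> nlinarith [hg z]
  · have hl : (z : ℂ).im * (q - (w : ℂ).re) = (w : ℂ).im * (q - (z : ℂ).re) :=
      (div_eq_div_iff (hqz z).ne' (hqz w).ne').1 hu
    by_cases hne : (z : ℂ).re = (w : ℂ).re
    · rw [hne] at hl
      exact Circle.ext (Complex.ext hne (mul_right_cancel₀ (hqz w).ne' hl))
    · rcases mul_neg_iff.1 (mul_sub_one_mul_neg_of_collinear hq (hsq z) (hsq w) hl hne) with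
        ⟨h1, h2⟩ | ⟨h1, h2⟩
      · exact absurd hG (hGlt z w (by linarith) (by linarith)).ne'
      · exact absurd hG (hGlt w z (by linarith) (by linarith)).ne

/-- Every real function on the circle is approximated by the first coordinate of an injective map
to the plane. -/
theorem Circle.exists_injective_approx (g : C(Circle, ℝ)) {ε : ℝ} (hε : 0 < ε) :
    ∃ G u : C(Circle, ℝ), (∀ z, |G z - g z| ≤ ε) ∧
      ∀ z w, G z = G w → u z = u w → z = w := by
  obtain ⟨p, -, hp⟩ := isCompact_univ.exists_isMaxOn Set.univ_nonempty
    (f := fun z => g z) (by fun_prop)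
  obtain ⟨G, u, hG, hinj⟩ := Circle.exists_injective_approx_of_max_one
    ⟨fun z => g (z * p), by fun_prop⟩ (fun z => by simpa using hp (Set.mem_univ (z * p)))
    (half_pos hε)
  refine ⟨⟨fun z => G (z / p), by fun_prop⟩, ⟨fun z => u (z / p), by fun_prop⟩, fun z => ?_,
    fun z w h1 h2 => div_left_injective (hinj _ _ h1 h2)⟩
  have := hG (z / p)
  simp only [ContinuousMap.coe_mk, div_mul_cancel] at this ⊢
  linarith

/-- If a circle map is injective together with a real function, then moving it radially by that
function makes it an embedding. -/
theorem Circle.exists_embedding_of_injective_prod {φ : C(Circle, Circle)} {ρ : C(Circle, ℝ)}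
    (h : ∀ z w, φ z = φ w → ρ z = ρ w → z = w) {ε : ℝ} (hε : 0 < ε) :
    ∃ f : Circle → ℂ, Continuous f ∧ Function.Injective f ∧ ∀ z, dist (f z) (φ z : ℂ) < ε := by
  obtain ⟨B, hB⟩ := isCompact_univ.exists_bound_of_continuousOn (f := ρ) (by fun_prop)
  have hB0 : 0 ≤ B := (norm_nonneg _).trans (hB 1 (Set.mem_univ 1))
  obtain ⟨η, hη, hηε, hη1⟩ : ∃ η : ℝ, 0 < η ∧ η * (B + 1) ≤ ε ∧ η * (B + 1) ≤ 1 := by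
    refine ⟨min ε 1 / (B + 1), by positivity, ?_, ?_⟩ <;>
      rw [div_mul_cancel₀ _ (by positivity)]
    exacts [min_le_left _ _, min_le_right _ _]
  have hbound (z : Circle) : |η * ρ z| < η * (B + 1) := by
    rw [abs_mul, abs_of_pos hη]
    have := hB z (Set.mem_univ z)
    rw [Real.norm_eq_abs] at this
    gcongr
    linarith
  have hpos (z : Circle) : 0 < 1 + η * ρ z := by linarith [(abs_lt.1 (hbound z)).1]
  refine ⟨fun z => ((1 + η * ρ z : ℝ) : ℂ) * φ z, by fun_prop, fun z w hzw => ?_, fun z => ?_⟩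
  · have hn := congrArg norm hzw
    simp only [norm_mul, Complex.norm_real, Circle.norm_coe, mul_one,
      Real.norm_of_nonneg (hpos _).le] at hn
    have hρ : ρ z = ρ w := mul_left_cancel₀ hη.ne' (by linarith)
    simp only [hρ] at hzw
    exact h z w (Circle.ext (mul_left_cancel₀ (by exact_mod_cast (hpos w).ne') hzw)) hρ
  · have he : ((1 + η * ρ z : ℝ) : ℂ) * φ z - φ z = ((η * ρ z : ℝ) : ℂ) * φ z := by
      push_cast; ring
    rw [Complex.dist_eq, he, norm_mul, Circle.norm_coe, mul_one, Complex.norm_real,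
      Real.norm_eq_abs]
    exact (hbound z).trans_le hηε

/-- The circle exponential does not increase distances. -/
theorem Circle.dist_exp_le (s t : ℝ) : dist (Circle.exp s : ℂ) (Circle.exp t) ≤ |s - t| := by
  have he : (Circle.exp s : ℂ) - Circle.exp t =
      Circle.exp t * (Complex.exp (Complex.I * (s - t : ℝ)) - 1) := by
    rw [Circle.coe_exp, Circle.coe_exp, mul_sub, ← Complex.exp_add, mul_one]
    congr 2
    push_cast; ring
  rw [Complex.dist_eq, he, norm_mul, Circle.norm_coe, one_mul]
  exact Real.norm_exp_I_mul_ofReal_sub_one_le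

/-- A null-homotopic map of the circle to itself is approximable by planar embeddings. -/
theorem Circle.exists_embedding_of_eq_const_mul_exp {φ : C(Circle, Circle)} {c : Circle}
    {g : C(Circle, ℝ)} (hφ : ∀ z, φ z = c * Circle.exp (g z)) {ε : ℝ} (hε : 0 < ε) :
    ∃ f : Circle → ℂ, Continuous f ∧ Function.Injective f ∧ ∀ z, dist (f z) (φ z : ℂ) < ε := by
  obtain ⟨G, u, hG, hinj⟩ := Circle.exists_injective_approx g (half_pos hε)
  obtain ⟨f, hf, hfi, hfd⟩ := Circle.exists_embedding_of_injective_prod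
    (φ := ⟨fun z => c * Circle.exp (G z), by fun_prop⟩)
    (ρ := ⟨fun z => G z + Real.arctan (u z), by fun_prop⟩) (fun z w h1 h2 => by
      simp only [ContinuousMap.coe_mk, mul_right_inj] at h1 h2
      obtain ⟨m, hm⟩ := Circle.exp_eq_exp.1 h1
      have hπ := Real.pi_pos
      have hm0 : m = 0 := by
        have h3 : (m : ℝ) * (2 * Real.pi) < 1 * (2 * Real.pi) := by
          linarith [Real.neg_pi_div_two_lt_arctan (u z), Real.arctan_lt_pi_div_two (u w)]
        have h4 : (-1 : ℝ) * (2 * Real.pi) < m * (2 * Real.pi) := by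
          linarith [Real.neg_pi_div_two_lt_arctan (u w), Real.arctan_lt_pi_div_two (u z)]
        have h5 : (m : ℝ) < 1 := lt_of_mul_lt_mul_right h3 (by positivity)
        have h6 : (-1 : ℝ) < m := lt_of_mul_lt_mul_right h4 (by positivity)
        have h7 : m < 1 := by exact_mod_cast h5
        have h8 : -1 < m := by exact_mod_cast h6
        omega
      have hGe : G z = G w := by simpa [hm0] using hm
      exact hinj z w hGe (Real.arctan_injective (by linarith))) (half_pos hε)
  refine ⟨f, hf, hfi, fun z => (dist_triangle _ _ _).trans_lt
    ((add_lt_add_of_lt_of_le (hfd z) ?_).trans_eq (add_halves ε))⟩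
  rw [hφ, ContinuousMap.coe_mk, Circle.coe_mul, Circle.coe_mul, dist_eq_norm, ← mul_sub, norm_mul,
    Circle.norm_coe, one_mul, ← dist_eq_norm]
  exact (Circle.dist_exp_le _ _).trans (hG z)

/-- A power map of the circle, up to an exponential, is not close to a planar embedding unless the
exponent is `-1`, `0` or `1`. -/
theorem Circle.not_injective_of_dist_lt_one {φ : C(Circle, Circle)} {n : ℤ} {g : C(Circle, ℝ)}
    (hφ : ∀ z, φ z = z ^ n * Circle.exp (g z)) (h0 : n ≠ 0) (h1 : n ≠ 1) (h2 : n ≠ -1)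
    {f : Circle → ℂ} (hf : Continuous f) (hd : ∀ z, dist (f z) (φ z : ℂ) < 1) :
    ¬ Function.Injective f := by
  have hslit (z : Circle) : f z / φ z ∈ Complex.slitPlane := by
    have hq : f z / φ z = 1 + (f z - φ z) / φ z := by
      field_simp [(φ z).coe_ne_zero]
      ring
    rw [hq]
    apply Complex.mem_slitPlane_of_norm_lt_one
    simpa [dist_eq_norm, Circle.norm_coe] using hd z
  have hc : Continuous fun z => f z / (φ z : ℂ) :=
    hf.div (by fun_prop) fun z => (φ z).coe_ne_zero
  have hfe : f = fun z : Circle => (z : ℂ) ^ n *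
      Complex.exp (Complex.log (f z / φ z) + g z * Complex.I) := by
    funext z
    rw [Complex.exp_add, Complex.exp_log (Complex.slitPlane_ne_zero (hslit z)),
      mul_left_comm, ← Circle.coe_exp, ← Circle.coe_zpow, ← Circle.coe_mul, ← hφ,
      div_mul_cancel₀ _ (φ z).coe_ne_zero]
  rw [hfe]
  exact Circle.not_injective_zpow_mul_exp h0 h1 h2
    ⟨fun z => Complex.log (f z / φ z) + g z * Complex.I, (hc.clog hslit).add (by fun_prop)⟩

/-- Sieklucki, 1969: A continuous map φ : S¹ → S¹ ⊂ ℂ, regarded as a map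
into the plane, is approximable by embeddings iff its degree lies in {-1, 0, 1}, i.e. iff
φ is homotopic to the identity, to the inversion z ↦ z⁻¹, or to a constant map. -/
theorem stmt_4 (φ : C(Circle, Circle)) :
    (∀ ε > (0 : ℝ), ∃ f : Circle → ℂ,
        Continuous f ∧ Function.Injective f ∧ ∀ z, dist (f z) ((φ z : ℂ)) < ε) ↔
    (φ.Homotopic (ContinuousMap.id Circle) ∨
     φ.Homotopic ⟨fun z => z⁻¹, continuous_inv⟩ ∨
     ∃ c : Circle, φ.Homotopic (ContinuousMap.const Circle c)) := by
  constructor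
  · intro h
    obtain ⟨f, hf, hfi, hfd⟩ := h 1 one_pos
    obtain ⟨n, g, hφ⟩ := Circle.exists_eq_zpow_mul_exp φ
    by_cases h0 : n = 0
    · subst h0
      exact .inr (.inr ⟨1, Circle.homotopic_of_eq_mul_exp (g := g) (by simpa using hφ)⟩)
    by_cases h1 : n = 1
    · subst h1
      exact .inl (Circle.homotopic_of_eq_mul_exp (g := g) (by simpa using hφ))
    by_cases h2 : n = -1
    · subst h2
      exact .inr (.inl (Circle.homotopic_of_eq_mul_exp (g := g) (by simpa using hφ)))
    exact absurd hfi (Circle.not_injective_of_dist_lt_one hφ h0 h1 h2 hf hfd)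
  · rintro (h | h | ⟨c, h⟩) ε hε
    · obtain ⟨g, hg⟩ := Circle.exists_eq_mul_exp_of_homotopic h
      refine Circle.exists_embedding_of_injective_prod (ρ := g) (fun z w h1 h2 => ?_) hε
      simpa [hg, h2] using h1
    · obtain ⟨g, hg⟩ := Circle.exists_eq_mul_exp_of_homotopic h
      refine Circle.exists_embedding_of_injective_prod (ρ := g) (fun z w h1 h2 => ?_) hε
      simpa [hg, h2] using h1
    · obtain ⟨g, hg⟩ := Circle.exists_eq_mul_exp_of_homotopic h
      exact Circle.exists_embedding_of_eq_const_mul_exp hg hε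
end

section
/- A path in the plane containing a transversal self-intersection is not approximable by embeddings. Precisely: let φ : [0,1] → ℝ² be continuous, and suppose there are 0 ≤ a < b < c < d ≤ 1 and points p₁, q₁, p₂, q₂ ∈ ℝ² such that φ restricted to [a,b] is the affine parametrization t ↦ p₁ + ((t-a)/(b-a))·(q₁-p₁) of the segment [p₁,q₁], φ restricted to [c,d] is the affine parametrization of the segment [p₂,q₂], the vectors q₁-p₁ and q₂-p₂ are linearly independent, and the two segments intersect in exactly one point lying in the relative interior of each. Then φ is not approximable by embeddings. -/
open Complex Set

/-- Along a continuous real function on which `sin` stays positive, the oscillation is less than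
`π`. -/
theorem sub_lt_pi_of_sin_pos {θ : ℝ → ℝ} (hθ : Continuous θ) (h : ∀ t, 0 < Real.sin (θ t))
    (s t : ℝ) : θ t - θ s < Real.pi := by
  by_contra! hst
  obtain ⟨r, -, hr⟩ := intermediate_value_uIcc (a := s) (b := t) hθ.continuousOn
    (show θ s + Real.pi ∈ uIcc (θ s) (θ t) from
      mem_uIcc.2 (Or.inl ⟨by linarith [Real.pi_pos], by linarith⟩))
  have hneg := h r
  rw [hr, Real.sin_add_pi] at hneg
  linarith [h s]

theorem lt_of_sin_sub_pos {α β : ℝ} (h : α - β < Real.pi) (hs : 0 < Real.sin (β - α)) : α < β := by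
  by_contra! hle
  have := Real.sin_nonneg_of_nonneg_of_le_pi (x := α - β) (by linarith) h.le
  rw [← neg_sub, Real.sin_neg] at hs
  linarith

/-- A version of the Poincaré–Miranda theorem in the plane: a continuous map whose real part
changes sign between two vertical lines and whose imaginary part changes sign between two
horizontal lines has a zero. -/
theorem exists_eq_zero_of_sign_changes {G : ℝ × ℝ → ℂ} (hG : Continuous G) (x₀ x₁ y₀ y₁ : ℝ)
    (hleft : ∀ y, (G (x₀, y)).re < 0) (hright : ∀ y, 0 < (G (x₁, y)).re)
    (hbot : ∀ x, (G (x, y₀)).im < 0) (htop : ∀ x, 0 < (G (x, y₁)).im) :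
    ∃ z, G z = 0 := by
  by_contra! hne
  obtain ⟨L, ⟨-, hL⟩, -⟩ := isCoveringMapOn_exp.existsUnique_continuousMap_lifts
    (⟨G, hG⟩ : C(ℝ × ℝ, ℂ)) (a₀ := (0, 0)) (e₀ := log (G (0, 0))) (exp_log (hne _))
    (fun z => hne z)
  have hexp (z : ℝ × ℝ) : G z = exp (L z) := (congrFun hL z).symm
  let θ : ℝ × ℝ → ℝ := fun z => (L z).im
  have hθ : Continuous θ := continuous_im.comp L.continuous
  have hre (z : ℝ × ℝ) : (G z).re = Real.exp (L z).re * Real.cos (θ z) := by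
    rw [hexp, exp_re]
  have him (z : ℝ × ℝ) : (G z).im = Real.exp (L z).re * Real.sin (θ z) := by
    rw [hexp, exp_im]
  have hleft' (y : ℝ) : Real.cos (θ (x₀, y)) < 0 := by
    have h := hleft y
    rw [hre] at h
    exact (pos_iff_neg_of_mul_neg h).1 (Real.exp_pos _)
  have hright' (y : ℝ) : 0 < Real.cos (θ (x₁, y)) := by
    have h := hright y
    rw [hre] at h
    exact (pos_iff_pos_of_mul_pos h).1 (Real.exp_pos _)
  have hbot' (x : ℝ) : Real.sin (θ (x, y₀)) < 0 := by
    have h := hbot x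
    rw [him] at h
    exact (pos_iff_neg_of_mul_neg h).1 (Real.exp_pos _)
  have htop' (x : ℝ) : 0 < Real.sin (θ (x, y₁)) := by
    have h := htop x
    rw [him] at h
    exact (pos_iff_pos_of_mul_pos h).1 (Real.exp_pos _)
  have h₁ : θ (x₀, y₀) < θ (x₁, y₀) := by
    refine lt_of_sin_sub_pos ?_ ?_
    · have := sub_lt_pi_of_sin_pos (θ := fun x => θ (x, y₀) + Real.pi) (by fun_prop)
        (fun x => by rw [Real.sin_add_pi]; linarith [hbot' x]) x₁ x₀
      simpa using this
    · rw [Real.sin_sub]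
      nlinarith [mul_pos_of_neg_of_neg (hbot' x₁) (hleft' y₀),
        mul_neg_of_pos_of_neg (hright' y₀) (hbot' x₀)]
  have h₂ : θ (x₁, y₀) < θ (x₁, y₁) := by
    refine lt_of_sin_sub_pos ?_ ?_
    · have := sub_lt_pi_of_sin_pos (θ := fun y => θ (x₁, y) + Real.pi / 2) (by fun_prop)
        (fun y => by rw [Real.sin_add_pi_div_two]; exact hright' y) y₁ y₀
      simpa using this
    · rw [Real.sin_sub]
      nlinarith [mul_pos (htop' x₁) (hright' y₀), mul_neg_of_pos_of_neg (hright' y₁) (hbot' x₁)]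
  have h₃ : θ (x₁, y₁) < θ (x₀, y₁) := by
    refine lt_of_sin_sub_pos ?_ ?_
    · exact sub_lt_pi_of_sin_pos (θ := fun x => θ (x, y₁)) (by fun_prop) htop' x₀ x₁
    · rw [Real.sin_sub]
      nlinarith [mul_pos (htop' x₀) (hright' y₁), mul_neg_of_neg_of_pos (hleft' y₁) (htop' x₁)]
  have h₄ : θ (x₀, y₁) < θ (x₀, y₀) := by
    refine lt_of_sin_sub_pos ?_ ?_
    · have := sub_lt_pi_of_sin_pos (θ := fun y => θ (x₀, y) - Real.pi / 2) (by fun_prop)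
        (fun y => by rw [Real.sin_sub_pi_div_two]; linarith [hleft' y]) y₀ y₁
      simpa using this
    · rw [Real.sin_sub]
      nlinarith [mul_pos_of_neg_of_neg (hbot' x₀) (hleft' y₁),
        mul_neg_of_neg_of_pos (hleft' y₀) (htop' x₀)]
  linarith


/-- A path in the plane containing a transversal self-intersection is not
approximable by embeddings. -/
theorem stmt_6 (φ : Set.Icc (0 : ℝ) 1 → EuclideanSpace ℝ (Fin 2)) (hφ : Continuous φ)
    (a b c d : ℝ) (hab : a < b) (hbc : b < c) (hcd : c < d)
    (ha : 0 ≤ a) (hd : d ≤ 1)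
    (p₁ q₁ p₂ q₂ : EuclideanSpace ℝ (Fin 2))
    (haff₁ : ∀ t : Set.Icc (0 : ℝ) 1, (t : ℝ) ∈ Set.Icc a b →
      φ t = p₁ + (((t : ℝ) - a) / (b - a)) • (q₁ - p₁))
    (haff₂ : ∀ t : Set.Icc (0 : ℝ) 1, (t : ℝ) ∈ Set.Icc c d →
      φ t = p₂ + (((t : ℝ) - c) / (d - c)) • (q₂ - p₂))
    (hli : LinearIndependent ℝ ![q₁ - p₁, q₂ - p₂])
    (x : EuclideanSpace ℝ (Fin 2))
    (hint : segment ℝ p₁ q₁ ∩ segment ℝ p₂ q₂ = {x})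
    (hx₁ : x ∈ openSegment ℝ p₁ q₁) (hx₂ : x ∈ openSegment ℝ p₂ q₂) :
    ¬ (∀ ε > (0 : ℝ), ∃ f : Set.Icc (0 : ℝ) 1 → EuclideanSpace ℝ (Fin 2),
        Continuous f ∧ Function.Injective f ∧ ∀ t, dist (f t) (φ t) < ε) := by
  intro happ
  rw [openSegment_eq_image'] at hx₁ hx₂
  obtain ⟨l, ⟨hl0, hl1⟩, hl : p₁ + l • (q₁ - p₁) = x⟩ := hx₁
  obtain ⟨m, ⟨hm0, hm1⟩, hm : p₂ + m • (q₂ - p₂) = x⟩ := hx₂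
  obtain ⟨T, hTinj, hT₁, hT₂⟩ : ∃ T : EuclideanSpace ℝ (Fin 2) →L[ℝ] ℂ,
      Function.Injective T ∧ T (q₁ - p₁) = 1 ∧ T (q₂ - p₂) = I := by
    let B := basisOfLinearIndependentOfCardEqFinrank hli (by simp)
    let e := B.equiv basisOneI (Equiv.refl _)
    refine ⟨e.toContinuousLinearEquiv, e.injective, ?_, ?_⟩
    · have h := B.equiv_apply 0 basisOneI (Equiv.refl _)
      simpa [B] using h
    · have h := B.equiv_apply 1 basisOneI (Equiv.refl _)
      simpa [B] using h
  have hsub (s t : ℝ) : T ((p₁ + s • (q₁ - p₁)) - (p₂ + t • (q₂ - p₂))) = ⟨s - l, m - t⟩ := by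
    have h : (p₁ + s • (q₁ - p₁)) - (p₂ + t • (q₂ - p₂))
        = ((p₁ + l • (q₁ - p₁)) - (p₂ + m • (q₂ - p₂)))
          + ((s - l) • (q₁ - p₁) + (m - t) • (q₂ - p₂)) := by module
    rw [h, hl, hm, sub_self, zero_add, map_add, map_smul, map_smul, hT₁, hT₂]
    apply Complex.ext <;> simp
  obtain ⟨δ, hδ, hδl, hδl', hδm, hδm'⟩ : ∃ δ > 0, δ ≤ l ∧ δ ≤ 1 - l ∧ δ ≤ m ∧ δ ≤ 1 - m :=
    ⟨min (min l (1 - l)) (min m (1 - m)), by simp [hl0, hl1, hm0, hm1], by simp, by simp, by simp,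
      by simp⟩
  obtain ⟨f, hf, hinj, hdist⟩ := happ (δ / (2 * (‖T‖ + 1))) (by positivity)
  have hclose (s t : Icc (0 : ℝ) 1) : ‖T (f s - f t) - T (φ s - φ t)‖ < δ := by
    have h : ‖(f s - φ s) - (f t - φ t)‖ ≤ δ / (‖T‖ + 1) := by
      have hs := hdist s
      have ht := hdist t
      rw [dist_eq_norm] at hs ht
      calc _ ≤ ‖f s - φ s‖ + ‖f t - φ t‖ := norm_sub_le _ _
        _ ≤ δ / (2 * (‖T‖ + 1)) + δ / (2 * (‖T‖ + 1)) := by gcongr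
        _ = δ / (‖T‖ + 1) := by field_simp; norm_num
    calc ‖T (f s - f t) - T (φ s - φ t)‖ = ‖T ((f s - φ s) - (f t - φ t))‖ := by
          rw [← map_sub]; congr 2; abel
      _ ≤ ‖T‖ * (δ / (‖T‖ + 1)) := T.le_opNorm_of_le h
      _ < (‖T‖ + 1) * (δ / (‖T‖ + 1)) := by gcongr; linarith
      _ = δ := by field_simp
  have hreim (s t : Icc (0 : ℝ) 1) (hs : (s : ℝ) ∈ Icc a b) (ht : (t : ℝ) ∈ Icc c d) :
      |(T (f s - f t)).re - ((s - a) / (b - a) - l)| < δ ∧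
      |(T (f s - f t)).im - (m - (t - c) / (d - c))| < δ := by
    have h := hclose s t
    rw [haff₁ s hs, haff₂ t ht, hsub] at h
    refine ⟨lt_of_le_of_lt ?_ h, lt_of_le_of_lt ?_ h⟩
    · exact abs_re_le_norm (T (f s - f t) - ⟨(s - a) / (b - a) - l, m - (t - c) / (d - c)⟩)
    · exact abs_im_le_norm (T (f s - f t) - ⟨(s - a) / (b - a) - l, m - (t - c) / (d - c)⟩)
  have hab' : Icc a b ⊆ Icc (0 : ℝ) 1 := Icc_subset_Icc ha (by linarith)
  have hcd' : Icc c d ⊆ Icc (0 : ℝ) 1 := Icc_subset_Icc (by linarith) hd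
  let σ : ℝ → Icc (0 : ℝ) 1 := fun x => inclusion hab' (projIcc a b hab.le x)
  let τ : ℝ → Icc (0 : ℝ) 1 := fun y => inclusion hcd' (projIcc c d hcd.le y)
  have hσ : Continuous σ := (continuous_inclusion hab').comp continuous_projIcc
  have hτ : Continuous τ := (continuous_inclusion hcd').comp continuous_projIcc
  have hσmem (x : ℝ) : (σ x : ℝ) ∈ Icc a b := (projIcc a b hab.le x).2
  have hτmem (y : ℝ) : (τ y : ℝ) ∈ Icc c d := (projIcc c d hcd.le y).2
  have hσa : (σ a : ℝ) = a := by simp [σ]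
  have hσb : (σ b : ℝ) = b := by simp [σ]
  have hτc : (τ c : ℝ) = c := by simp [τ]
  have hτd : (τ d : ℝ) = d := by simp [τ]
  obtain ⟨⟨s, t⟩, hst⟩ := exists_eq_zero_of_sign_changes
    (G := fun z => T (f (σ z.1) - f (τ z.2))) (by fun_prop) a b d c
    (fun y => by
      have h := (hreim (σ a) (τ y) (hσmem a) (hτmem y)).1
      rw [hσa, sub_self, zero_div, abs_lt] at h
      linarith [h.2])
    (fun y => by
      have h := (hreim (σ b) (τ y) (hσmem b) (hτmem y)).1
      rw [hσb, div_self (sub_pos.2 hab).ne', abs_lt] at h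
      linarith [h.1])
    (fun x => by
      have h := (hreim (σ x) (τ d) (hσmem x) (hτmem d)).2
      rw [hτd, div_self (sub_pos.2 hcd).ne', abs_lt] at h
      linarith [h.2])
    (fun x => by
      have h := (hreim (σ x) (τ c) (hσmem x) (hτmem c)).2
      rw [hτc, sub_self, zero_div, abs_lt] at h
      linarith [h.1])
  have heq : σ s = τ t := hinj (sub_eq_zero.1 (hTinj (by simpa using hst)))
  have h := (hσmem s).2
  rw [heq] at h
  linarith [(hτmem t).1]
end
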